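/- arXiv:1911.01942 — 2 statements merged into one kernel-verified Lean document; each statement's English description precedes it below -/
import Mathlib

section
/- Let X be a real Banach space, a < b real numbers, and u, u' : ℝ → X functions such that u' is Bochner integrable on [a,b], ‖u'(·)‖² is integrable on [a,b], and u(t) = u(a) + ∫_a^t u'(s) ds for all t ∈ [a,b]. Then ∫_a^b ‖u(t) − Iu(t)‖² dt ≤ (b−a)²·∫_a^b ‖u'(s)‖² ds, where Iu is the linear interpolant of u on [a,b]. -/
open MeasureTheory intervalIntegral

/-- Cauchy–Schwarz against the constant function on a compact interval. -/
theorem sq_intervalIntegral_le_mul_intervalIntegral_sq {f : ℝ → ℝ} {a b : ℝ} (hab : a < b)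
    (hf : IntervalIntegrable f volume a b)
    (hf2 : IntervalIntegrable (fun s => f s ^ 2) volume a b) :
    (∫ s in a..b, f s) ^ 2 ≤ (b - a) * ∫ s in a..b, f s ^ 2 := by
  have hba : 0 < b - a := sub_pos.2 hab
  set G := ∫ s in a..b, f s with hG
  have key : ∫ s in a..b, ((b - a) * f s - G) ^ 2 =
      (b - a) * ((b - a) * (∫ s in a..b, f s ^ 2) - G ^ 2) := by
    have expand : ∀ s, ((b - a) * f s - G) ^ 2 =
        (b - a) ^ 2 * f s ^ 2 - 2 * (b - a) * G * f s + G ^ 2 := fun s => by ring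
    simp_rw [expand]
    rw [integral_add ((hf2.const_mul _).sub (hf.const_mul _)) intervalIntegrable_const,
      integral_sub (hf2.const_mul _) (hf.const_mul _), intervalIntegral.integral_const_mul,
      intervalIntegral.integral_const_mul, intervalIntegral.integral_const, ← hG, smul_eq_mul]
    ring
  have hnonneg : 0 ≤ ∫ s in a..b, ((b - a) * f s - G) ^ 2 :=
    integral_nonneg hab.le fun s _ => sq_nonneg _
  rw [key] at hnonneg
  exact sub_nonneg.1 (nonneg_of_mul_nonneg_right hnonneg hba)

/-- The error of linear interpolation is bounded by the total variation `∫_a^b ‖u'‖`. -/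
theorem norm_sub_linear_interpolant_le
    {X : Type*} [NormedAddCommGroup X] [NormedSpace ℝ X]
    {a b : ℝ} (hab : a < b) {u u' : ℝ → X}
    (hint : IntervalIntegrable u' volume a b)
    (hu : ∀ t ∈ Set.Icc a b, u t = u a + ∫ s in a..t, u' s) {t : ℝ} (ht : t ∈ Set.Icc a b) :
    ‖u t - (b - a)⁻¹ • ((b - t) • u a + (t - a) • u b)‖ ≤ ∫ s in a..b, ‖u' s‖ := by
  have hba : 0 < b - a := sub_pos.2 hab
  have ht' : t ∈ Set.uIcc a b := Set.Icc_subset_uIcc ht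
  have h₁ : IntervalIntegrable u' volume a t :=
    hint.mono_set (Set.uIcc_subset_uIcc_left ht')
  have h₂ : IntervalIntegrable u' volume t b :=
    hint.mono_set (Set.uIcc_subset_uIcc_right ht')
  have hp := norm_integral_le_integral_norm (f := u') (μ := volume) ht.1
  have hq := norm_integral_le_integral_norm (f := u') (μ := volume) ht.2
  have hub := hu b (Set.right_mem_Icc.2 hab.le)
  rw [← integral_add_adjacent_intervals h₁ h₂] at hub
  rw [← integral_add_adjacent_intervals h₁.norm h₂.norm, hub, hu t ht]
  set p := ∫ s in a..t, u' s
  set q := ∫ s in t..b, u' s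
  have hsplit : u a + p - (b - a)⁻¹ • ((b - t) • u a + (t - a) • (u a + (p + q))) =
      ((b - t) / (b - a)) • p - ((t - a) / (b - a)) • q := by
    match_scalars <;> field_simp <;> ring
  have hbt : ‖((b - t) / (b - a)) • p‖ ≤ ‖p‖ := by
    rw [norm_smul, Real.norm_of_nonneg (div_nonneg (sub_nonneg.2 ht.2) hba.le)]
    exact mul_le_of_le_one_left (norm_nonneg _) ((div_le_one hba).2 (by linarith [ht.1]))
  have hta : ‖((t - a) / (b - a)) • q‖ ≤ ‖q‖ := by
    rw [norm_smul, Real.norm_of_nonneg (div_nonneg (sub_nonneg.2 ht.1) hba.le)]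
    exact mul_le_of_le_one_left (norm_nonneg _) ((div_le_one hba).2 (by linarith [ht.2]))
  rw [hsplit]
  exact (norm_sub_le _ _).trans (add_le_add (hbt.trans hp) (hta.trans hq))

/-- Single-interval form of the first estimate of Lemma 4.1 (thm:tp:lagrange):
`∫_a^b ‖u − Iu‖² ≤ (b−a)²·∫_a^b ‖u'‖²` for the linear interpolant
`Iu t = ((b−t)•u a + (t−a)•u b)/(b−a)`. -/
theorem linear_interpolant_L2_bound
    {X : Type*} [NormedAddCommGroup X] [NormedSpace ℝ X] [CompleteSpace X]
    (a b : ℝ) (hab : a < b) (u u' : ℝ → X)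
    (hint : IntervalIntegrable u' volume a b)
    (hint2 : IntervalIntegrable (fun s => ‖u' s‖ ^ 2) volume a b)
    (hu : ∀ t ∈ Set.Icc a b, u t = u a + ∫ s in a..t, u' s) :
    (∫ t in a..b, ‖u t - (b - a)⁻¹ • ((b - t) • u a + (t - a) • u b)‖ ^ 2) ≤
      (b - a) ^ 2 * ∫ s in a..b, ‖u' s‖ ^ 2 := by
  have hba : 0 < b - a := sub_pos.2 hab
  have hcs := sq_intervalIntegral_le_mul_intervalIntegral_sq hab hint.norm hint2
  have hconst := norm_integral_le_of_norm_le_const (a := a) (b := b)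
    (f := fun t => ‖u t - (b - a)⁻¹ • ((b - t) • u a + (t - a) • u b)‖ ^ 2)
    (C := (∫ s in a..b, ‖u' s‖) ^ 2) fun t ht => by
      rw [Set.uIoc_of_le hab.le] at ht
      rw [norm_pow, norm_norm]
      exact pow_le_pow_left₀ (norm_nonneg _)
        (norm_sub_linear_interpolant_le hab hint hu (Set.Ioc_subset_Icc_self ht)) 2
  rw [abs_of_pos hba] at hconst
  calc _ ≤ (∫ s in a..b, ‖u' s‖) ^ 2 * (b - a) := (Real.le_norm_self _).trans hconst
    _ ≤ ((b - a) * ∫ s in a..b, ‖u' s‖ ^ 2) * (b - a) := by gcongr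
    _ = _ := by ring
end

section
/- Let H be a real Hilbert space, S ⊆ H a closed subspace, and P : H → H the orthogonal projection onto S. Let a < b be real numbers and u, u', u'' : ℝ → H functions such that u' and u'' are Bochner integrable on [a,b], ‖u''(·)‖² is integrable on [a,b], u(t) = u(a) + ∫_a^t u'(s) ds and u'(t) = u'(a) + ∫_a^t u''(s) ds for all t ∈ [a,b]. Then, with the projected linear interpolant Ju(t) = ((b−t)·P(u(a)) + (t−a)·P(u(b)))/(b−a), whose derivative is the constant (P(u(b)) − P(u(a)))/(b−a), one has ∫_a^b ‖u'(t) − (P(u(b)) − P(u(a)))/(b−a)‖² dt ≤ 2·(b−a)²·∫_a^b ‖u''(r)‖² dr + 4·( ‖u(a) − P(u(a))‖² + ‖u(b) − P(u(b))‖² )/(b−a). -/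
open MeasureTheory intervalIntegral

/-- Cauchy–Schwarz against the constant function `1` on an interval. -/
theorem sq_intervalIntegral_le {a b : ℝ} (hab : a < b) {g : ℝ → ℝ}
    (hg : IntervalIntegrable g volume a b)
    (hg2 : IntervalIntegrable (fun r => g r ^ 2) volume a b) :
    (∫ r in a..b, g r) ^ 2 ≤ (b - a) * ∫ r in a..b, g r ^ 2 := by
  have hba : 0 < b - a := sub_pos.2 hab
  set K := ∫ r in a..b, g r with hK
  have hnonneg : 0 ≤ ∫ r in a..b, (g r ^ 2 - 2 * (K / (b - a)) * g r + (K / (b - a)) ^ 2) := by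
    refine intervalIntegral.integral_nonneg hab.le fun r _ => ?_
    nlinarith [sq_nonneg (g r - K / (b - a))]
  rw [intervalIntegral.integral_add (hg2.sub (hg.const_mul _)) intervalIntegrable_const,
    intervalIntegral.integral_sub hg2 (hg.const_mul _), intervalIntegral.integral_const_mul,
    intervalIntegral.integral_const, ← hK, smul_eq_mul] at hnonneg
  have key := mul_nonneg hba.le hnonneg
  have : (b - a) * ((∫ r in a..b, g r ^ 2) - 2 * (K / (b - a)) * K + (b - a) * (K / (b - a)) ^ 2)
      = (b - a) * (∫ r in a..b, g r ^ 2) - K ^ 2 := by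
    field_simp
    ring
  linarith

/-- A function with integrable derivative `f'` differs from its mean over `[a, b]` by at most the
`L¹` norm of `f'`. -/
theorem norm_sub_mean_le_integral_norm {E : Type*} [NormedAddCommGroup E] [NormedSpace ℝ E]
    [CompleteSpace E] {a b : ℝ} (hab : a < b) {f f' : ℝ → E}
    (hf : IntervalIntegrable f volume a b) (hf' : IntervalIntegrable f' volume a b)
    (h : ∀ t ∈ Set.Icc a b, f t = f a + ∫ s in a..t, f' s) {t : ℝ} (ht : t ∈ Set.Icc a b) :
    ‖f t - (b - a)⁻¹ • ∫ s in a..b, f s‖ ≤ ∫ r in a..b, ‖f' r‖ := by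
  have hba : 0 < b - a := sub_pos.2 hab
  have hsub : ∀ s ∈ Set.Icc a b, IntervalIntegrable f' volume a s := fun s hs =>
    hf'.mono_set (Set.uIcc_subset_uIcc_left (Set.uIcc_of_le hab.le ▸ hs))
  have hosc : ∀ s ∈ Set.Icc a b, ‖f t - f s‖ ≤ ∫ r in a..b, ‖f' r‖ := by
    intro s hs
    rw [h t ht, h s hs, add_sub_add_left_eq_sub,
      intervalIntegral.integral_interval_sub_left (hsub t ht) (hsub s hs)]
    refine intervalIntegral.norm_integral_le_integral_norm_uIoc.trans ?_
    rw [intervalIntegral.integral_of_le hab.le]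
    refine setIntegral_mono_set hf'.norm.1 (ae_of_all _ fun _ => norm_nonneg _) ?_
    exact (Set.Ioc_subset_Ioc (le_min hs.1 ht.1) (max_le hs.2 ht.2)).eventuallyLE
  have hmean : f t - (b - a)⁻¹ • ∫ s in a..b, f s = (b - a)⁻¹ • ∫ s in a..b, (f t - f s) := by
    rw [intervalIntegral.integral_sub intervalIntegrable_const hf,
      intervalIntegral.integral_const, smul_sub, inv_smul_smul₀ hba.ne']
  have hbound := intervalIntegral.norm_integral_le_of_norm_le_const (a := a) (b := b)
    (f := fun s => f t - f s) fun s hs =>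
      hosc s (Set.Ioc_subset_Icc_self (Set.uIoc_of_le hab.le ▸ hs))
  rw [abs_of_pos hba] at hbound
  rw [hmean, norm_smul, norm_inv, Real.norm_of_nonneg hba.le, inv_mul_le_iff₀ hba]
  linarith

/-- Single-interval abstract form of the derivative estimate of Theorem 4.3
(thm:tp): the derivative of the projected linear interpolant is the constant
`(P(u b) − P(u a))/(b−a)` and satisfies the stated L² bound. -/
theorem projected_linear_interpolant_derivative_L2_bound
    {H : Type*} [NormedAddCommGroup H] [InnerProductSpace ℝ H] [CompleteSpace H]
    (S : Submodule ℝ H) (hS : IsClosed (S : Set H))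
    (P : H → H) (hPmem : ∀ x : H, P x ∈ S)
    (hPorth : ∀ x : H, ∀ y ∈ S, inner (𝕜 := ℝ) (x - P x) y = 0)
    (a b : ℝ) (hab : a < b) (u u' u'' : ℝ → H)
    (hint1 : IntervalIntegrable u' volume a b)
    (hint2 : IntervalIntegrable u'' volume a b)
    (hint3 : IntervalIntegrable (fun r => ‖u'' r‖ ^ 2) volume a b)
    (hu : ∀ t ∈ Set.Icc a b, u t = u a + ∫ s in a..t, u' s)
    (hu' : ∀ t ∈ Set.Icc a b, u' t = u' a + ∫ s in a..t, u'' s) :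
    (∫ t in a..b, ‖u' t - (b - a)⁻¹ • (P (u b) - P (u a))‖ ^ 2) ≤
      2 * (b - a) ^ 2 * (∫ r in a..b, ‖u'' r‖ ^ 2) +
        4 * (‖u a - P (u a)‖ ^ 2 + ‖u b - P (u b)‖ ^ 2) / (b - a) := by
  have hba : 0 < b - a := sub_pos.2 hab
  set K := ∫ r in a..b, ‖u'' r‖ with hK
  have hCS : K ^ 2 ≤ (b - a) * ∫ r in a..b, ‖u'' r‖ ^ 2 := sq_intervalIntegral_le hab hint2.norm hint3
  have hdiff : ∫ s in a..b, u' s = u b - u a := by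
    rw [hu b (Set.right_mem_Icc.2 hab.le), add_sub_cancel_left]
  set D := ‖u a - P (u a)‖ ^ 2 + ‖u b - P (u b)‖ ^ 2 with hD
  have hpoint : ∀ t ∈ Set.uIoc a b, ‖‖u' t - (b - a)⁻¹ • (P (u b) - P (u a))‖ ^ 2‖ ≤
      2 * K ^ 2 + 4 * D / (b - a) ^ 2 := by
    intro t ht
    have hmean := norm_sub_mean_le_integral_norm hab hint1 hint2 hu'
      (Set.Ioc_subset_Icc_self (Set.uIoc_of_le hab.le ▸ ht))
    rw [hdiff, ← hK] at hmean
    have hsplit : u' t - (b - a)⁻¹ • (P (u b) - P (u a)) = (u' t - (b - a)⁻¹ • (u b - u a)) +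
        (b - a)⁻¹ • ((u b - P (u b)) - (u a - P (u a))) := by
      module
    have hnodal : ‖(b - a)⁻¹ • ((u b - P (u b)) - (u a - P (u a)))‖ ^ 2 ≤
        2 * D / (b - a) ^ 2 := by
      rw [norm_smul, norm_inv, Real.norm_of_nonneg hba.le, mul_pow, inv_pow, inv_mul_eq_div]
      gcongr
      have h := norm_sub_le (u b - P (u b)) (u a - P (u a))
      have := pow_le_pow_left₀ (norm_nonneg _) h 2
      linarith [add_sq_le (a := ‖u b - P (u b)‖) (b := ‖u a - P (u a)‖)]
    rw [Real.norm_of_nonneg (sq_nonneg _), hsplit]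
    have h1 := (pow_le_pow_left₀ (norm_nonneg _) (norm_add_le (u' t - (b - a)⁻¹ • (u b - u a))
      ((b - a)⁻¹ • ((u b - P (u b)) - (u a - P (u a))))) 2).trans add_sq_le
    have h2 := pow_le_pow_left₀ (norm_nonneg _) hmean 2
    have h3 : 4 * D / (b - a) ^ 2 = 2 * (2 * D / (b - a) ^ 2) := by ring
    linarith
  have hbound := (le_abs_self _).trans (intervalIntegral.norm_integral_le_of_norm_le_const hpoint)
  rw [abs_of_pos hba] at hbound
  have hexpand : (2 * K ^ 2 + 4 * D / (b - a) ^ 2) * (b - a) =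
      2 * (b - a) * K ^ 2 + 4 * D / (b - a) := by
    field_simp
  have := mul_le_mul_of_nonneg_left hCS (by positivity : 0 ≤ 2 * (b - a))
  linarith
end
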